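/- Let M be a matroid on a finite ground set E, let K be an integer with 1 ≤ K ≤ rank(M), and let G be any group of automorphisms of M (a subgroup of Aut(M)). Then there exists a maximizer p* of F_{M,K} over the probability simplex Δ(E) that is constant on each G-orbit of E, i.e., p*_{g(e)} = p*_e for all g ∈ G and e ∈ E. -/

import Mathlib

open Finset Classical

/-- `F_{M,K}(p) = K! · ∑_{S ∈ I(M), |S| = K} ∏_{e ∈ S} p_e`. -/
noncomputable def indepProb {α : Type*} [Fintype α] (M : Matroid α) (K : ℕ)
    (p : α → ℝ) : ℝ :=
  (K.factorial : ℝ) *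
    ∑ S ∈ Finset.univ.powersetCard K, if M.Indep (S : Set α) then ∏ e ∈ S, p e else 0

/-- A real symmetric matrix all of whose eigenvectors with positive eigenvalue are proportional
to `w` is negative semidefinite on the orthogonal complement of `w`. -/
theorem Matrix.IsHermitian.dotProduct_mulVec_nonpos {α : Type*} [Fintype α]
    {A : Matrix α α ℝ} (hA : A.IsHermitian) (w : α → ℝ)
    (h : ∀ l : ℝ, 0 < l → ∀ u : α → ℝ, A.mulVec u = l • u → ∃ c : ℝ, u = c • w)
    (x : α → ℝ) (hx : x ⬝ᵥ w = 0) : x ⬝ᵥ A.mulVec x ≤ 0 := by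
  have key := hA.eigenvectorBasis.sum_inner_mul_inner (WithLp.toLp 2 x) (WithLp.toLp 2 (A.mulVec x))
  simp only [EuclideanSpace.inner_eq_star_dotProduct, star_trivial] at key
  rw [dotProduct_comm x, ← key]
  refine Finset.sum_nonpos fun j _ => ?_
  have hj := hA.mulVec_eigenvectorBasis j
  set u : α → ℝ := (hA.eigenvectorBasis j).ofLp with hu
  have h1 : A.mulVec x ⬝ᵥ u = hA.eigenvalues j * (u ⬝ᵥ x) := by
    rw [dotProduct_comm, Matrix.dotProduct_mulVec, ← Matrix.mulVec_transpose]
    have : A.transpose = A := (Matrix.conjTranspose_eq_transpose_of_trivial A).symm.trans hA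
    rw [this, hj, smul_dotProduct, smul_eq_mul]
  rw [h1]
  by_cases hl : hA.eigenvalues j ≤ 0
  · nlinarith [mul_self_nonneg (u ⬝ᵥ x)]
  · obtain ⟨c, hc⟩ := h _ (not_le.1 hl) u hj
    rw [hc, smul_dotProduct, dotProduct_comm w, hx]
    simp

/-- Generalized eigenvalue form of `Matrix.IsHermitian.dotProduct_mulVec_nonpos`, relative to a
nonnegative diagonal weight `D`. -/
theorem sum_sum_mul_nonpos_of_weighted_eigenvectors {α : Type*} [Fintype α]
    (H : α → α → ℝ) (hH : ∀ i j, H i j = H j i) (D w : α → ℝ) (hD : ∀ i, 0 ≤ D i)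
    (hHD : ∀ i, D i = 0 → ∀ j, H i j = 0)
    (h : ∀ l : ℝ, 0 < l → ∀ v : α → ℝ, (∀ i, ∑ j, H i j * v j = l * (D i * v i)) →
      ∃ c : ℝ, ∀ i, D i * v i = c * (D i * w i))
    (x : α → ℝ) (hx : ∑ i, D i * w i * x i = 0) :
    ∑ i, ∑ j, x i * H i j * x j ≤ 0 := by
  set s : α → ℝ := fun i => √(D i) with hs
  have hss : ∀ i, s i * s i = D i := fun i => Real.mul_self_sqrt (hD i)
  have hs0 : ∀ i, s i = 0 → D i = 0 := fun i hi => by rw [← hss, hi, zero_mul]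
  have hcancel : ∀ i j, s i * (H i j / (s i * s j)) * s j = H i j := by
    intro i j
    by_cases hi : s i = 0
    · rw [hHD i (hs0 i hi)]; simp
    by_cases hj : s j = 0
    · rw [hH, hHD j (hs0 j hj)]; simp
    field_simp
  have := Matrix.IsHermitian.dotProduct_mulVec_nonpos
    (A := Matrix.of fun i j => H i j / (s i * s j))
    (by ext i j; simp [hH i j, mul_comm (s i)]) (fun i => s i * w i) ?_ (fun i => s i * x i) ?_
  · convert this using 1
    simp only [dotProduct, Matrix.mulVec, Matrix.of_apply, Finset.mul_sum]
    refine Finset.sum_congr rfl fun i _ => Finset.sum_congr rfl fun j _ => ?_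
    linear_combination (-(x i * x j)) * hcancel i j
  · intro l hl u hu
    have hu' : ∀ i, ∑ j, H i j / (s i * s j) * u j = l * u i := fun i => by
      simpa [Matrix.mulVec, dotProduct] using congrFun hu i
    have hu0 : ∀ i, s i = 0 → u i = 0 := by
      intro i hi
      have := hu' i
      simp only [hi, zero_mul, div_zero, Finset.sum_const_zero] at this
      exact (mul_eq_zero.1 this.symm).resolve_left hl.ne'
    have hus : ∀ i, s i * (u i / s i) = u i := by
      intro i
      by_cases hi : s i = 0
      · simp [hi, hu0 i hi]
      · field_simp
    obtain ⟨c, hc⟩ := h l hl (fun i => u i / s i) (by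
      intro i
      have h1 : l * (D i * (u i / s i)) = s i * (l * u i) := by
        rw [← hss]; linear_combination (l * s i) * hus i
      rw [h1, ← hu', Finset.mul_sum]
      refine Finset.sum_congr rfl fun j _ => ?_
      rw [← hcancel i j]
      by_cases hj : s j = 0
      · simp [hj]
      · by_cases hi : s i = 0
        · simp [hi]
        · field_simp)
    refine ⟨c, funext fun i => ?_⟩
    by_cases hi : s i = 0
    · simp [hi, hu0 i hi]
    · have h2 := hc i
      rw [← hss] at h2
      simp only [Pi.smul_apply, smul_eq_mul]
      refine mul_left_cancel₀ hi ?_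
      linear_combination h2 - s i * hus i
  · rw [← hx]
    simp only [dotProduct]
    refine Finset.sum_congr rfl fun i _ => ?_
    rw [← hss]; ring

section LinkPolynomials

variable {α : Type*}

/-- The generating polynomial of the link of `T` in the set family `𝓕`, evaluated at `p`. -/
noncomputable def linkPoly (𝓕 : Finset (Finset α)) (T : Finset α) (p : α → ℝ) : ℝ :=
  ∑ S ∈ 𝓕 with T ⊆ S, ∏ e ∈ S \ T, p e

/-- The partial derivative of `linkPoly 𝓕 T` in the coordinate `i`. -/
noncomputable def linkGrad (𝓕 : Finset (Finset α)) (T : Finset α) (p : α → ℝ) (i : α) : ℝ :=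
  if i ∈ T then 0 else linkPoly 𝓕 (insert i T) p

/-- The second partial derivative of `linkPoly 𝓕 T` in the coordinates `i` and `j`. -/
noncomputable def linkHess (𝓕 : Finset (Finset α)) (T : Finset α) (p : α → ℝ) (i j : α) : ℝ :=
  if i ∈ T then 0 else linkGrad 𝓕 (insert i T) p j

variable {𝓕 : Finset (Finset α)} {T : Finset α} {p : α → ℝ}

theorem linkHess_symm (i j : α) : linkHess 𝓕 T p i j = linkHess 𝓕 T p j i := by
  by_cases hij : i = j
  · rw [hij]
  · simp only [linkHess, linkGrad, Finset.mem_insert, hij, Ne.symm hij, false_or,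
      Finset.insert_comm i j]
    split_ifs <;> rfl

theorem linkPoly_nonneg (hp : ∀ e, 0 ≤ p e) : 0 ≤ linkPoly 𝓕 T p :=
  Finset.sum_nonneg fun _ _ => Finset.prod_nonneg fun e _ => hp e

theorem linkGrad_nonneg (hp : ∀ e, 0 ≤ p e) (i : α) : 0 ≤ linkGrad 𝓕 T p i := by
  unfold linkGrad
  split_ifs
  exacts [le_rfl, linkPoly_nonneg hp]

theorem linkHess_nonneg (hp : ∀ e, 0 ≤ p e) (i j : α) : 0 ≤ linkHess 𝓕 T p i j := by
  unfold linkHess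
  split_ifs
  exacts [le_rfl, linkGrad_nonneg hp j]

theorem linkPoly_mono {q : α → ℝ} (hp : ∀ e, 0 ≤ p e) (hpq : ∀ e, p e ≤ q e) :
    linkPoly 𝓕 T p ≤ linkPoly 𝓕 T q :=
  Finset.sum_le_sum fun _ _ => Finset.prod_le_prod (fun e _ => hp e) fun e _ => hpq e

theorem linkPoly_pos_iff (hp : ∀ e, 0 < p e) : 0 < linkPoly 𝓕 T p ↔ ∃ S ∈ 𝓕, T ⊆ S := by
  constructor
  · intro h
    by_contra! hS
    have : linkPoly 𝓕 T p = 0 := by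
      rw [linkPoly, Finset.filter_false_of_mem hS, Finset.sum_empty]
    exact h.ne' this
  · rintro ⟨S, hS, hTS⟩
    exact Finset.sum_pos (fun _ _ => Finset.prod_pos fun e _ => hp e)
      ⟨S, Finset.mem_filter.2 ⟨hS, hTS⟩⟩

theorem continuous_linkPoly (𝓕 : Finset (Finset α)) (T : Finset α) :
    Continuous (linkPoly 𝓕 T) :=
  continuous_finsetSum _ fun _ _ => continuous_finsetProd _ fun e _ => continuous_apply e

variable [Fintype α]

theorem sum_mul_linkGrad (v : α → ℝ) :
    ∑ i, v i * linkGrad 𝓕 T p i =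
      ∑ S ∈ 𝓕 with T ⊆ S, ∑ i ∈ S \ T, (∏ e ∈ (S \ T).erase i, p e) * v i := by
  simp only [linkGrad, linkPoly, Finset.sum_filter]
  have h1 : ∀ i, v i * (if i ∈ T then 0 else
      ∑ S ∈ 𝓕, if insert i T ⊆ S then ∏ e ∈ S \ insert i T, p e else 0) =
      ∑ S ∈ 𝓕, if T ⊆ S ∧ i ∈ S \ T then (∏ e ∈ (S \ T).erase i, p e) * v i else 0 := by
    intro i
    split_ifs with hi
    · simp [hi]
    · rw [Finset.mul_sum]
      refine Finset.sum_congr rfl fun S _ => ?_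
      simp only [Finset.insert_subset_iff, Finset.mem_sdiff, hi, not_false_eq_true, and_true,
        and_comm (a := T ⊆ S), Finset.sdiff_insert]
      split_ifs
      · rw [mul_comm]
      · simp
  simp only [h1]
  rw [Finset.sum_comm]
  refine Finset.sum_congr rfl fun S _ => ?_
  by_cases hS : T ⊆ S
  · simp only [hS, true_and, if_true]
    rw [← Finset.sum_filter, Finset.filter_mem_eq_inter, Finset.univ_inter]
  · simp [hS]

variable {K : ℕ}

/-- Euler's identity for `linkPoly`. -/
theorem sum_mul_linkGrad_self (h𝓕 : ∀ S ∈ 𝓕, S.card = K) :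
    ∑ i, p i * linkGrad 𝓕 T p i = ((K : ℝ) - T.card) * linkPoly 𝓕 T p := by
  rw [sum_mul_linkGrad, linkPoly, Finset.mul_sum]
  refine Finset.sum_congr rfl fun S hS => ?_
  obtain ⟨hS, hTS⟩ := Finset.mem_filter.1 hS
  rw [Finset.sum_congr rfl fun i hi => Finset.prod_erase_mul _ _ hi, Finset.sum_const,
    Finset.card_sdiff_of_subset hTS, nsmul_eq_mul, Nat.cast_sub (Finset.card_le_card hTS), h𝓕 S hS]

/-- Euler's identity for `linkGrad`. -/
theorem sum_linkHess_mul_self (h𝓕 : ∀ S ∈ 𝓕, S.card = K) (i : α) :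
    ∑ j, linkHess 𝓕 T p i j * p j = ((K : ℝ) - T.card - 1) * linkGrad 𝓕 T p i := by
  by_cases hi : i ∈ T
  · simp [linkHess, linkGrad, hi]
  · have := sum_mul_linkGrad_self (T := insert i T) (p := p) h𝓕
    simp only [linkHess, linkGrad, hi, if_false]
    rw [Finset.card_insert_of_notMem hi] at this
    push_cast at this
    simp only [mul_comm _ (p _)]
    rw [show (K : ℝ) - T.card - 1 = K - (T.card + 1) by ring, ← this]
    simp only [linkGrad]

/-- Euler's identity for `linkHess`. -/
theorem sum_mul_linkHess_insert (h𝓕 : ∀ S ∈ 𝓕, S.card = K) (i j : α) :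
    ∑ k, p k * (if k ∈ T then 0 else linkHess 𝓕 (insert k T) p i j) =
      ((K : ℝ) - T.card - 2) * linkHess 𝓕 T p i j := by
  by_cases hi : i ∈ T
  · simp [linkHess, hi]
  by_cases hj : j ∈ T
  · simp [linkHess, linkGrad, hj]
  by_cases hij : i = j
  · simp [linkHess, linkGrad, hij]
  have h := sum_mul_linkGrad_self (T := insert i (insert j T)) (p := p) h𝓕
  rw [Finset.card_insert_of_notMem (by simp [hi, hij]), Finset.card_insert_of_notMem hj] at h
  have h2 : linkHess 𝓕 T p i j = linkPoly 𝓕 (insert i (insert j T)) p := by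
    simp [linkHess, linkGrad, hi, hj, Ne.symm hij, Finset.insert_comm i j]
  rw [h2]
  push_cast at h
  rw [show (K : ℝ) - T.card - 2 = K - (T.card + 1 + 1) by ring, ← h]
  refine Finset.sum_congr rfl fun k _ => ?_
  congr 1
  simp only [linkHess, linkGrad, Finset.mem_insert, hi, hj, Ne.symm hij, or_false, false_or]
  have e : insert j (insert i (insert k T)) = insert k (insert i (insert j T)) := by
    ext x; simp only [Finset.mem_insert]; tauto
  rw [e]
  by_cases hk : k ∈ T <;> by_cases hki : k = i <;> by_cases hkj : k = j <;>
    simp [hk, hki, hkj, eq_comm]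
  all_goals grind

theorem hasDerivAt_linkPoly (x v : α → ℝ) (t : ℝ) :
    HasDerivAt (fun s : ℝ => linkPoly 𝓕 T fun e => x e + s * v e)
      (∑ i, v i * linkGrad 𝓕 T (fun e => x e + t * v e) i) t := by
  rw [sum_mul_linkGrad]
  unfold linkPoly
  refine HasDerivAt.fun_sum fun S _ => ?_
  refine HasDerivAt.fun_finsetProd (f := fun e s => x e + s * v e) (f' := v) fun i _ => ?_
  simpa using ((hasDerivAt_id t).mul_const (v i)).const_add (x i)

theorem hasDerivAt_linkGrad (x v : α → ℝ) (t : ℝ) (i : α) :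
    HasDerivAt (fun s : ℝ => linkGrad 𝓕 T (fun e => x e + s * v e) i)
      (∑ j, v j * linkHess 𝓕 T (fun e => x e + t * v e) i j) t := by
  by_cases hi : i ∈ T
  · simpa [linkGrad, linkHess, hi] using hasDerivAt_const t (0 : ℝ)
  · simpa only [linkGrad, linkHess, hi, if_false] using hasDerivAt_linkPoly x v t

/-- The Hessian quadratic form of `linkPoly 𝓕 T` at `p`. -/
noncomputable def linkForm (𝓕 : Finset (Finset α)) (T : Finset α) (p v : α → ℝ) : ℝ :=
  ∑ i, ∑ j, v i * linkHess 𝓕 T p i j * v j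

/-- The Hodge–Riemann type inequality saying that the Hessian of `linkPoly 𝓕 T` at `p` has at
most one positive eigenvalue. -/
def IsHyperbolicLink (𝓕 : Finset (Finset α)) (K : ℕ) (T : Finset α) (p : α → ℝ) : Prop :=
  ∀ v : α → ℝ, ((K : ℝ) - T.card) * linkPoly 𝓕 T p * linkForm 𝓕 T p v ≤
    ((K : ℝ) - T.card - 1) * (∑ i, v i * linkGrad 𝓕 T p i) ^ 2

theorem linkForm_sub_smul (h𝓕 : ∀ S ∈ 𝓕, S.card = K) (v : α → ℝ) (c : ℝ) :
    linkForm 𝓕 T p (fun i => v i - c * p i) = linkForm 𝓕 T p v -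
      2 * c * (((K : ℝ) - T.card - 1) * ∑ i, v i * linkGrad 𝓕 T p i) +
      c ^ 2 * (((K : ℝ) - T.card - 1) * (((K : ℝ) - T.card) * linkPoly 𝓕 T p)) := by
  have h1 : ∀ u : α → ℝ, ∑ i, ∑ j, u i * linkHess 𝓕 T p i j * p j =
      ((K : ℝ) - T.card - 1) * ∑ i, u i * linkGrad 𝓕 T p i := by
    intro u
    rw [Finset.mul_sum]
    refine Finset.sum_congr rfl fun i _ => ?_
    simp only [mul_assoc, ← Finset.mul_sum, sum_linkHess_mul_self h𝓕 i]
    ring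
  have h2 : ∑ i, ∑ j, p i * linkHess 𝓕 T p i j * v j =
      ∑ i, ∑ j, v i * linkHess 𝓕 T p i j * p j := by
    rw [Finset.sum_comm]
    refine Finset.sum_congr rfl fun i _ => Finset.sum_congr rfl fun j _ => ?_
    rw [linkHess_symm]; ring
  rw [← sum_mul_linkGrad_self h𝓕, ← h1 v, ← h1 p]
  rw [show ∀ a b d : ℝ, a - 2 * c * b + d = a - c * b - c * b + d by intros; ring]
  nth_rewrite 2 [← h2]
  simp only [linkForm, Finset.mul_sum, ← Finset.sum_sub_distrib, ← Finset.sum_add_distrib]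
  refine Finset.sum_congr rfl fun i _ => Finset.sum_congr rfl fun j _ => ?_
  ring

theorem isHyperbolicLink_of_shift (h𝓕 : ∀ S ∈ 𝓕, S.card = K) (hp : ∀ e, 0 < p e)
    (hT : T.card + 1 ≤ K)
    (h : 0 < linkPoly 𝓕 T p → ∀ v : α → ℝ, ∃ c : ℝ,
      linkForm 𝓕 T p (fun i => v i - c * p i) ≤ 0) :
    IsHyperbolicLink 𝓕 K T p := by
  intro v
  have hd : (0 : ℝ) ≤ (K : ℝ) - T.card - 1 := by
    have : ((T.card + 1 : ℕ) : ℝ) ≤ K := Nat.cast_le.2 hT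
    push_cast at this; linarith
  rcases (linkPoly_nonneg (𝓕 := 𝓕) (T := T) fun e => (hp e).le).eq_or_lt with h0 | h0
  · rw [← h0]; simp only [mul_zero, zero_mul]; positivity
  · obtain ⟨c, hc⟩ := h h0 v
    rw [linkForm_sub_smul h𝓕] at hc
    set s := ∑ i, v i * linkGrad 𝓕 T p i
    set g := linkPoly 𝓕 T p
    set d := (K : ℝ) - T.card
    have h1 : 0 ≤ d * g := mul_nonneg (by linarith) h0.le
    have h2 := mul_le_mul_of_nonneg_left hc h1
    have h3 := mul_nonneg hd (sq_nonneg (s - c * (d * g)))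
    nlinarith

/-- The Dirichlet form associated with the Hessian. -/
theorem sum_sum_linkHess_sq_sub (h𝓕 : ∀ S ∈ 𝓕, S.card = K) (hp : ∀ e, 0 < p e) (v : α → ℝ) :
    ∑ i, ∑ j, linkHess 𝓕 T p i j * p i * p j * (v i / p i - v j / p j) ^ 2 =
      2 * (∑ i, ((K : ℝ) - T.card - 1) * linkGrad 𝓕 T p i / p i * v i ^ 2 -
        linkForm 𝓕 T p v) := by
  have h1 : ∑ i, ((K : ℝ) - T.card - 1) * linkGrad 𝓕 T p i / p i * v i ^ 2 =
      ∑ i, ∑ j, linkHess 𝓕 T p i j * p j / p i * v i ^ 2 := by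
    refine Finset.sum_congr rfl fun i _ => ?_
    rw [← sum_linkHess_mul_self h𝓕, Finset.sum_div, Finset.sum_mul]
  have h2 : ∑ i, ∑ j, linkHess 𝓕 T p i j * p j / p i * v i ^ 2 =
      ∑ i, ∑ j, linkHess 𝓕 T p i j * p i / p j * v j ^ 2 := by
    rw [Finset.sum_comm]
    refine Finset.sum_congr rfl fun i _ => Finset.sum_congr rfl fun j _ => ?_
    rw [linkHess_symm]
  rw [h1, show ∀ a b : ℝ, 2 * (a - b) = a + a - 2 * b by intros; ring]
  nth_rewrite 2 [h2]
  simp only [linkForm, Finset.mul_sum, ← Finset.sum_sub_distrib, ← Finset.sum_add_distrib]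
  refine Finset.sum_congr rfl fun i _ => Finset.sum_congr rfl fun j _ => ?_
  have := (hp i).ne'
  have := (hp j).ne'
  field_simp
  ring

theorem linkForm_insert_eq_zero (hp : ∀ e, 0 < p e) {i : α} (hi : linkGrad 𝓕 T p i = 0)
    (hiT : i ∉ T) (v : α → ℝ) : linkForm 𝓕 (insert i T) p v = 0 := by
  have h0 : ∀ U, insert i T ⊆ U → linkPoly 𝓕 U p = 0 := by
    intro U hU
    by_contra hne
    obtain ⟨S, hS, hUS⟩ := (linkPoly_pos_iff hp).1
      ((linkPoly_nonneg fun e => (hp e).le).lt_of_ne' hne)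
    have := (linkPoly_pos_iff hp).2 ⟨S, hS, hU.trans hUS⟩
    simp only [linkGrad, hiT, if_false] at hi
    exact this.ne' hi
  refine Finset.sum_eq_zero fun a _ => Finset.sum_eq_zero fun b _ => ?_
  have : linkHess 𝓕 (insert i T) p a b = 0 := by
    unfold linkHess linkGrad
    rw [h0 _ ((Finset.subset_insert _ _).trans (Finset.subset_insert _ _))]
    simp
  rw [this]; ring

/-- If all vertex links are hyperbolic, then an eigenvector `v` of the Hessian relative to the
vertex weights, with eigenvalue `l`, has Hessian form at most `l ^ 2` times its weighted norm. -/
theorem linkForm_le_of_eigenvector (h𝓕 : ∀ S ∈ 𝓕, S.card = K) (hp : ∀ e, 0 < p e)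
    (hT : T.card + 3 ≤ K) (ih : ∀ i ∉ T, IsHyperbolicLink 𝓕 K (insert i T) p)
    {l : ℝ} {v : α → ℝ} (hv : ∀ i, ∑ j, linkHess 𝓕 T p i j * v j =
      l * (((K : ℝ) - T.card - 1) * linkGrad 𝓕 T p i / p i * v i)) :
    linkForm 𝓕 T p v ≤
      l ^ 2 * ∑ i, ((K : ℝ) - T.card - 1) * linkGrad 𝓕 T p i / p i * v i ^ 2 := by
  have hd : (0 : ℝ) < (K : ℝ) - T.card - 2 := by
    have : ((T.card + 3 : ℕ) : ℝ) ≤ K := Nat.cast_le.2 hT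
    push_cast at this; linarith
  have h1 : ((K : ℝ) - T.card - 2) * linkForm 𝓕 T p v =
      ∑ k, p k * (if k ∈ T then 0 else linkForm 𝓕 (insert k T) p v) := by
    have e : ∀ k, p k * (if k ∈ T then 0 else linkForm 𝓕 (insert k T) p v) =
        ∑ i, ∑ j, v i * (p k * if k ∈ T then 0 else linkHess 𝓕 (insert k T) p i j) * v j := by
      intro k
      split_ifs
      · simp
      · simp only [linkForm, Finset.mul_sum]
        refine Finset.sum_congr rfl fun i _ => Finset.sum_congr rfl fun j _ => ?_
        ring
    simp only [e]
    rw [Finset.sum_comm, linkForm, Finset.mul_sum]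
    refine Finset.sum_congr rfl fun i _ => ?_
    rw [Finset.sum_comm, Finset.mul_sum]
    refine Finset.sum_congr rfl fun j _ => ?_
    rw [← Finset.sum_mul, ← Finset.mul_sum, sum_mul_linkHess_insert h𝓕]
    ring
  refine le_of_mul_le_mul_left ?_ hd
  rw [h1, Finset.mul_sum, Finset.mul_sum]
  refine Finset.sum_le_sum fun i _ => ?_
  have hpi := hp i
  have hg := linkGrad_nonneg (𝓕 := 𝓕) (T := T) (fun e => (hp e).le) i
  have hd1 : (0 : ℝ) < (K : ℝ) - T.card - 1 := by linarith
  by_cases hi : i ∈ T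
  · simp only [hi, if_true, mul_zero]
    positivity
  rcases hg.eq_or_lt with h0 | h0
  · rw [if_neg hi, linkForm_insert_eq_zero hp h0.symm hi]
    rw [← h0]; simp
  have h2 := ih i hi v
  have h3 : ∑ j, v j * linkGrad 𝓕 (insert i T) p j = ∑ j, linkHess 𝓕 T p i j * v j := by
    refine Finset.sum_congr rfl fun j _ => ?_
    simp only [linkHess, hi, if_false, mul_comm]
  rw [h3, hv, Finset.card_insert_of_notMem hi] at h2
  have h4 : linkPoly 𝓕 (insert i T) p = linkGrad 𝓕 T p i := by simp [linkGrad, hi]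
  rw [h4] at h2
  push_cast at h2
  rw [if_neg hi]
  set Q := linkForm 𝓕 (insert i T) p v
  set L := linkGrad 𝓕 T p i
  set d := (K : ℝ) - T.card with hdd
  rw [show (K : ℝ) - (T.card + 1) = d - 1 by rw [hdd]; ring] at h2
  have h5 : 0 < (d - 1) * L := mul_pos hd1 h0
  refine le_of_mul_le_mul_left ?_ h5
  calc (d - 1) * L * (p i * Q) = p i * ((d - 1) * L * Q) := by ring
    _ ≤ p i * ((d - 1 - 1) * (l * ((d - 1) * L / p i * v i)) ^ 2) :=
        mul_le_mul_of_nonneg_left h2 hpi.le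
    _ = _ := by field_simp; ring

/-- Local-to-global principle: a connected link all of whose vertex links are hyperbolic is
hyperbolic. -/
theorem isHyperbolicLink_of_forall_insert (h𝓕 : ∀ S ∈ 𝓕, S.card = K) (hp : ∀ e, 0 < p e)
    (hT : T.card + 3 ≤ K) (ih : ∀ i ∉ T, IsHyperbolicLink 𝓕 K (insert i T) p)
    (hconn : ∀ i j, 0 < linkGrad 𝓕 T p i → 0 < linkGrad 𝓕 T p j → i = j ∨
      0 < linkHess 𝓕 T p i j ∨ ∃ k, 0 < linkHess 𝓕 T p i k ∧ 0 < linkHess 𝓕 T p k j) :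
    IsHyperbolicLink 𝓕 K T p := by
  have hp0 : ∀ e, 0 ≤ p e := fun e => (hp e).le
  have hd : (0 : ℝ) < (K : ℝ) - T.card - 2 := by
    have : ((T.card + 3 : ℕ) : ℝ) ≤ K := Nat.cast_le.2 hT
    push_cast at this; linarith
  have hd1 : (0 : ℝ) < (K : ℝ) - T.card - 1 := by linarith
  have hd0 : (0 : ℝ) < (K : ℝ) - T.card := by linarith
  set D : α → ℝ := fun i => ((K : ℝ) - T.card - 1) * linkGrad 𝓕 T p i / p i with hD
  have hDnn : ∀ i, 0 ≤ D i := fun i =>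
    div_nonneg (mul_nonneg hd1.le (linkGrad_nonneg hp0 i)) (hp0 i)
  have hDg : ∀ i, D i = 0 ↔ linkGrad 𝓕 T p i = 0 := by
    intro i
    simp [hD, (hp i).ne', hd1.ne']
  have hHD : ∀ i, D i = 0 → ∀ j, linkHess 𝓕 T p i j = 0 := by
    intro i hi j
    have h1 := sum_linkHess_mul_self (T := T) (p := p) h𝓕 i
    rw [(hDg i).1 hi, mul_zero, Finset.sum_eq_zero_iff_of_nonneg fun j _ =>
      mul_nonneg (linkHess_nonneg hp0 i j) (hp0 j)] at h1
    exact (mul_eq_zero.1 (h1 j (Finset.mem_univ j))).resolve_right (hp j).ne'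
  have heig : ∀ l : ℝ, 0 < l → ∀ v : α → ℝ,
      (∀ i, ∑ j, linkHess 𝓕 T p i j * v j = l * (D i * v i)) →
      ∃ c : ℝ, ∀ i, D i * v i = c * (D i * p i) := by
    intro l hl v hv
    have hEnn : ∀ i, 0 ≤ D i * v i ^ 2 := fun i => mul_nonneg (hDnn i) (sq_nonneg _)
    have hle := linkForm_le_of_eigenvector h𝓕 hp hT ih hv
    have hQ : linkForm 𝓕 T p v = l * ∑ i, D i * v i ^ 2 := by
      rw [linkForm, Finset.mul_sum]
      refine Finset.sum_congr rfl fun i _ => ?_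
      simp only [mul_assoc, ← Finset.mul_sum, hv]
      ring
    have hdir := sum_sum_linkHess_sq_sub (T := T) h𝓕 hp v
    change linkForm 𝓕 T p v ≤ l ^ 2 * ∑ i, D i * v i ^ 2 at hle
    change _ = 2 * (∑ i, D i * v i ^ 2 - _) at hdir
    rw [hQ] at hdir hle
    have hterm : ∀ i j, 0 ≤ linkHess 𝓕 T p i j * p i * p j * (v i / p i - v j / p j) ^ 2 :=
      fun i j => mul_nonneg (mul_nonneg (mul_nonneg (linkHess_nonneg hp0 i j) (hp0 i)) (hp0 j))
        (sq_nonneg _)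
    have hsum := Finset.sum_nonneg fun i (_ : i ∈ Finset.univ) =>
      Finset.sum_nonneg fun j (_ : j ∈ Finset.univ) => hterm i j
    by_cases hE : ∑ i, D i * v i ^ 2 = 0
    · rw [Finset.sum_eq_zero_iff_of_nonneg fun i _ => hEnn i] at hE
      refine ⟨0, fun i => ?_⟩
      rcases mul_eq_zero.1 (hE i (Finset.mem_univ i)) with h | h
      · simp [h]
      · simp [pow_eq_zero_iff two_ne_zero |>.1 h]
    · set E := ∑ i, D i * v i ^ 2
      have hEpos : 0 < E := (Finset.sum_nonneg fun i _ => hEnn i).lt_of_ne' hE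
      have hl1 : 1 ≤ l := by
        have h : l * E * 1 ≤ l * E * l := by linarith [hle, show l ^ 2 * E = l * E * l by ring]
        exact le_of_mul_le_mul_left h (mul_pos hl hEpos)
      have hz : ∑ i, ∑ j, linkHess 𝓕 T p i j * p i * p j * (v i / p i - v j / p j) ^ 2 = 0 := by
        refine le_antisymm ?_ hsum
        rw [hdir]
        nlinarith
      have hadj : ∀ i j, 0 < linkHess 𝓕 T p i j → v i / p i = v j / p j := by
        intro i j hij
        rw [Finset.sum_eq_zero_iff_of_nonneg fun i _ =>
          Finset.sum_nonneg fun j _ => hterm i j] at hz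
        have h1 := hz i (Finset.mem_univ i)
        rw [Finset.sum_eq_zero_iff_of_nonneg fun j _ => hterm i j] at h1
        have h2 := h1 j (Finset.mem_univ j)
        have h3 := mul_pos (mul_pos hij (hp i)) (hp j)
        have h4 := (mul_eq_zero.1 h2).resolve_left h3.ne'
        linarith [pow_eq_zero_iff two_ne_zero |>.1 h4]
      obtain ⟨i₀, -, hi₀⟩ := Finset.exists_ne_zero_of_sum_ne_zero hE
      have hg : ∀ i, D i ≠ 0 → 0 < linkGrad 𝓕 T p i := fun i hi =>
        (linkGrad_nonneg hp0 i).lt_of_ne' fun h => hi ((hDg i).2 h)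
      refine ⟨v i₀ / p i₀, fun i => ?_⟩
      by_cases hi : D i = 0
      · simp [hi]
      have : v i / p i = v i₀ / p i₀ := by
        rcases hconn i i₀ (hg i hi) (hg i₀ fun h => hi₀ (by simp [h])) with h | h | ⟨k, h, h'⟩
        · rw [h]
        · exact hadj _ _ h
        · rw [hadj _ _ h, hadj _ _ h']
      rw [← this]
      have := (hp i).ne'
      field_simp
  refine isHyperbolicLink_of_shift h𝓕 hp (by omega) fun hpos v =>
    ⟨(∑ i, v i * linkGrad 𝓕 T p i) / (((K : ℝ) - T.card) * linkPoly 𝓕 T p), ?_⟩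
  refine sum_sum_mul_nonpos_of_weighted_eigenvectors _ linkHess_symm D p hDnn hHD heig _ ?_
  have h1 : ∀ i, D i * p i = ((K : ℝ) - T.card - 1) * linkGrad 𝓕 T p i := fun i =>
    div_mul_cancel₀ _ (hp i).ne'
  simp only [h1]
  set c := (∑ i, v i * linkGrad 𝓕 T p i) / (((K : ℝ) - T.card) * linkPoly 𝓕 T p) with hc
  have h2 : ∑ i, v i * linkGrad 𝓕 T p i = c * ∑ i, p i * linkGrad 𝓕 T p i := by
    rw [sum_mul_linkGrad_self h𝓕, hc, div_mul_cancel₀ _ (mul_pos hd0 hpos).ne']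
  have h3 : ∀ i, ((K : ℝ) - T.card - 1) * linkGrad 𝓕 T p i * (v i - c * p i) =
      ((K : ℝ) - T.card - 1) * (v i * linkGrad 𝓕 T p i - c * (p i * linkGrad 𝓕 T p i)) :=
    fun i => by ring
  simp only [h3]
  rw [← Finset.mul_sum, Finset.sum_sub_distrib, ← Finset.mul_sum, h2, sub_self, mul_zero]

/-- The independent sets of cardinality `K`. -/
noncomputable def indepFamily (M : Matroid α) (K : ℕ) : Finset (Finset α) :=
  {S ∈ Finset.univ.powersetCard K | M.Indep (S : Set α)}

theorem mem_indepFamily {M : Matroid α} {S : Finset α} :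
    S ∈ indepFamily M K ↔ S.card = K ∧ M.Indep (S : Set α) := by
  simp [indepFamily, Finset.mem_powersetCard]

theorem exists_mem_indepFamily_superset {M : Matroid α}
    (hrank : ∃ I : Finset α, M.Indep (I : Set α) ∧ I.card = K) (hT : M.Indep (T : Set α))
    (hTK : T.card ≤ K) : ∃ S ∈ indepFamily M K, T ⊆ S := by
  obtain ⟨I, hI, hIK⟩ := hrank
  obtain ⟨n, hn⟩ := Nat.exists_eq_add_of_le hTK
  induction n generalizing T with
  | zero => exact ⟨T, mem_indepFamily.2 ⟨by omega, hT⟩, Finset.Subset.refl _⟩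
  | succ n ihn =>
    obtain ⟨e, -, heT, he⟩ := hT.augment_finset hI (by omega)
    rw [← Finset.coe_insert] at he
    have hc := Finset.card_insert_of_notMem heT
    obtain ⟨S, hS, hTS⟩ := ihn he (by omega) (by omega)
    exact ⟨S, hS, (Finset.subset_insert _ _).trans hTS⟩

theorem linkPoly_indepFamily_pos_iff {M : Matroid α}
    (hrank : ∃ I : Finset α, M.Indep (I : Set α) ∧ I.card = K) (hp : ∀ e, 0 < p e) :
    0 < linkPoly (indepFamily M K) T p ↔ M.Indep (T : Set α) ∧ T.card ≤ K := by
  rw [linkPoly_pos_iff hp]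
  constructor
  · rintro ⟨S, hS, hTS⟩
    obtain ⟨hSK, hSi⟩ := mem_indepFamily.1 hS
    exact ⟨hSi.subset (Finset.coe_subset.2 hTS), hSK ▸ Finset.card_le_card hTS⟩
  · rintro ⟨h1, h2⟩
    exact exists_mem_indepFamily_superset hrank h1 h2

theorem linkGrad_indepFamily_pos_iff {M : Matroid α}
    (hrank : ∃ I : Finset α, M.Indep (I : Set α) ∧ I.card = K) (hp : ∀ e, 0 < p e) {i : α} :
    0 < linkGrad (indepFamily M K) T p i ↔
      i ∉ T ∧ M.Indep (insert i T : Finset α) ∧ T.card + 1 ≤ K := by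
  unfold linkGrad
  split_ifs with hi
  · simp [hi]
  · rw [linkPoly_indepFamily_pos_iff hrank hp, Finset.card_insert_of_notMem hi]
    simp [hi]

theorem linkHess_indepFamily_pos_iff {M : Matroid α}
    (hrank : ∃ I : Finset α, M.Indep (I : Set α) ∧ I.card = K) (hp : ∀ e, 0 < p e) {i j : α} :
    0 < linkHess (indepFamily M K) T p i j ↔ i ∉ T ∧ j ∉ insert i T ∧
      M.Indep (insert j (insert i T) : Finset α) ∧ T.card + 2 ≤ K := by
  unfold linkHess
  split_ifs with hi
  · simp [hi]
  · rw [linkGrad_indepFamily_pos_iff hrank hp, Finset.card_insert_of_notMem hi]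
    simp only [hi, not_false_eq_true, true_and]

/-- Links of the truncated independence complex of dimension at least one are connected. -/
theorem linkHess_indepFamily_connected {M : Matroid α}
    (hrank : ∃ I : Finset α, M.Indep (I : Set α) ∧ I.card = K) (hp : ∀ e, 0 < p e)
    (hT : T.card + 2 ≤ K) {i j : α}
    (hi : 0 < linkGrad (indepFamily M K) T p i) (hj : 0 < linkGrad (indepFamily M K) T p j) :
    i = j ∨ 0 < linkHess (indepFamily M K) T p i j ∨
      ∃ k, 0 < linkHess (indepFamily M K) T p i k ∧ 0 < linkHess (indepFamily M K) T p k j := by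
  rw [linkGrad_indepFamily_pos_iff hrank hp] at hi hj
  obtain ⟨hiT, hi, -⟩ := hi
  obtain ⟨hjT, hj, -⟩ := hj
  by_cases hij : i = j
  · exact Or.inl hij
  by_cases hadj : M.Indep (insert j (insert i T) : Finset α)
  · refine Or.inr (Or.inl ((linkHess_indepFamily_pos_iff hrank hp).2 ⟨hiT, ?_, hadj, hT⟩))
    simp [hjT, Ne.symm hij]
  refine Or.inr (Or.inr ?_)
  have hci := Finset.card_insert_of_notMem hiT
  have hcj := Finset.card_insert_of_notMem hjT
  obtain ⟨I, hI, hIK⟩ := hrank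
  obtain ⟨k, -, hk, hik⟩ := hi.augment_finset hI (by omega)
  rw [← Finset.coe_insert] at hik
  have hck := Finset.card_insert_of_notMem hk
  obtain ⟨e, he, heT, hje⟩ := hj.augment_finset hik (by omega)
  rw [← Finset.coe_insert] at hje
  have hek : e = k := by
    simp only [Finset.mem_insert, not_or] at he heT
    rcases he with h | h | h
    · exact h
    · rw [h, Finset.insert_comm] at hje
      exact absurd hje hadj
    · exact absurd h heT.2
  subst hek
  refine ⟨e, (linkHess_indepFamily_pos_iff ⟨I, hI, hIK⟩ hp).2 ⟨hiT, hk, hik, hT⟩, ?_⟩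
  rw [linkHess_symm]
  exact (linkHess_indepFamily_pos_iff ⟨I, hI, hIK⟩ hp).2 ⟨hjT, heT, hje, hT⟩

theorem sum_sum_ite_eq_nonneg {β : Type*} [DecidableEq β] (c : α → β) (y : α → ℝ) :
    0 ≤ ∑ i, ∑ j, if c i = c j then y i * y j else 0 := by
  have h : ∑ i, ∑ j, (if c i = c j then y i * y j else 0) =
      ∑ b ∈ Finset.univ.image c, (∑ i, if c i = b then y i else 0) ^ 2 := by
    simp only [sq, Finset.sum_mul_sum]
    rw [Finset.sum_comm]
    simp only [Finset.sum_comm (s := Finset.univ.image c)]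
    rw [Finset.sum_comm]
    refine Finset.sum_congr rfl fun i _ => Finset.sum_congr rfl fun j _ => ?_
    rw [Finset.sum_eq_single (c i)]
    · simp [eq_comm]
    · intro b _ hb
      simp [hb.symm]
    · simp
  rw [h]
  exact Finset.sum_nonneg fun _ _ => sq_nonneg _

theorem linkHess_eq_zero_or_one (h𝓕 : ∀ S ∈ 𝓕, S.card = K) (hT : T.card + 2 = K) (i j : α) :
    linkHess 𝓕 T p i j = 0 ∨ linkHess 𝓕 T p i j = 1 := by
  unfold linkHess linkGrad
  split_ifs with hi hj
  · exact Or.inl rfl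
  · exact Or.inl rfl
  have hc := Finset.card_insert_of_notMem hj
  rw [Finset.card_insert_of_notMem hi] at hc
  set U := insert j (insert i T)
  have hU : ∀ S ∈ 𝓕, U ⊆ S → S = U := fun S hS hUS =>
    (Finset.eq_of_subset_of_card_le hUS (by rw [h𝓕 S hS]; omega)).symm
  by_cases hmem : U ∈ 𝓕
  · right
    rw [linkPoly, Finset.sum_eq_single U]
    · simp
    · intro S hS hne
      exact absurd (hU S (Finset.mem_filter.1 hS).1 (Finset.mem_filter.1 hS).2) hne
    · intro h
      exact absurd (Finset.mem_filter.2 ⟨hmem, Finset.Subset.refl _⟩) h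
  · left
    refine Finset.sum_eq_zero fun S hS => ?_
    obtain ⟨hS, hUS⟩ := Finset.mem_filter.1 hS
    exact absurd (hU S hS hUS ▸ hS) hmem

/-- Rank-two links are complete multipartite graphs, hence hyperbolic. -/
theorem isHyperbolicLink_indepFamily_of_card_add_two {M : Matroid α} (hE : M.E = Set.univ)
    (hrank : ∃ I : Finset α, M.Indep (I : Set α) ∧ I.card = K) (hp : ∀ e, 0 < p e)
    (hT : T.card + 2 = K) : IsHyperbolicLink (indepFamily M K) K T p := by
  have h𝓕 : ∀ S ∈ indepFamily M K, S.card = K := fun S hS => (mem_indepFamily.1 hS).1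
  refine isHyperbolicLink_of_shift h𝓕 hp (by omega) fun hpos => ?_
  have hTi := ((linkPoly_indepFamily_pos_iff hrank hp).1 hpos).1
  set N : α → Prop := fun i => i ∉ M.closure (T : Set α) with hN
  set c : α → Set α := fun i => M.closure (insert i (T : Set α)) with hc
  have hmem : ∀ i, i ∈ c i := fun i =>
    M.subset_closure _ (by rw [hE]; exact Set.subset_univ _) (Set.mem_insert _ _)
  have hNiff : ∀ i, N i ↔ M.Indep (insert i (T : Set α)) ∧ i ∉ T := fun i => by
    simpa using hTi.notMem_closure_iff (e := i) (by rw [hE]; trivial)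
  have hH : ∀ i j, linkHess (indepFamily M K) T p i j =
      if N i ∧ N j ∧ c i ≠ c j then 1 else 0 := by
    intro i j
    have hiff : 0 < linkHess (indepFamily M K) T p i j ↔ N i ∧ N j ∧ c i ≠ c j := by
      rw [linkHess_indepFamily_pos_iff hrank hp]
      have hji : N i → (j ∉ c i ↔ M.Indep (insert j (insert i (T : Set α))) ∧
          j ∉ insert i (T : Set α)) := fun hi =>
        ((hNiff i).1 hi).1.notMem_closure_iff (by rw [hE]; trivial)
      constructor
      · rintro ⟨hi, hj, hind, -⟩
        rw [Finset.coe_insert, Finset.coe_insert] at hind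
        have hNi : N i := (hNiff i).2 ⟨hind.subset (Set.subset_insert _ _), hi⟩
        have hNj : N j := (hNiff j).2 ⟨hind.subset
          (Set.insert_subset_insert (Set.subset_insert _ _)), fun h => hj (by simp [h])⟩
        refine ⟨hNi, hNj, fun h => ?_⟩
        refine (hji hNi).2 ⟨hind, by simpa using hj⟩ ?_
        rw [h]; exact hmem j
      · rintro ⟨hNi, hNj, hne⟩
        have hj : j ∉ c i := fun hj => hne (Matroid.closure_insert_congr ⟨hj, hNj⟩).symm
        obtain ⟨h1, h2⟩ := (hji hNi).1 hj
        exact ⟨((hNiff i).1 hNi).2, by simpa using h2, by simpa using h1, hT.le⟩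
    split_ifs with h
    · exact (linkHess_eq_zero_or_one h𝓕 hT i j).resolve_left (hiff.2 h).ne'
    · exact (linkHess_eq_zero_or_one h𝓕 hT i j).resolve_right fun h1 =>
        h (hiff.1 (by rw [h1]; exact one_pos))
  have hQ : ∀ x : α → ℝ, linkForm (indepFamily M K) T p x ≤
      (∑ i, if N i then x i else 0) ^ 2 := by
    intro x
    have h := sum_sum_ite_eq_nonneg c fun i => if N i then x i else 0
    have h2 : linkForm (indepFamily M K) T p x = (∑ i, if N i then x i else 0) ^ 2 -
        ∑ i, ∑ j, if c i = c j then (if N i then x i else 0) * (if N j then x j else 0) else 0 := by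
      rw [sq, Finset.sum_mul_sum, linkForm]
      simp only [← Finset.sum_sub_distrib]
      refine Finset.sum_congr rfl fun i _ => Finset.sum_congr rfl fun j _ => ?_
      rw [hH]
      by_cases h1 : N i <;> by_cases h2 : N j <;> by_cases h3 : c i = c j <;> simp [h1, h2, h3]
    linarith
  have hp0 : ∑ i, (if N i then p i else 0) ≠ 0 := by
    intro h0
    have h1 := hQ p
    rw [h0] at h1
    have h2 := linkForm_sub_smul (T := T) (p := p) h𝓕 0 (-1)
    have hK : (K : ℝ) = T.card + 2 := by rw [← hT]; push_cast; ring
    simp only [Pi.zero_apply, zero_mul, Finset.sum_const_zero, mul_zero, sub_zero, hK] at h2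
    have h3 : linkForm (indepFamily M K) T p 0 = 0 := by simp [linkForm]
    rw [h3] at h2
    simp only [neg_mul, one_mul, zero_sub, neg_neg] at h2
    rw [h2] at h1
    nlinarith
  intro v
  refine ⟨(∑ i, if N i then v i else 0) / ∑ i, (if N i then p i else 0), (hQ _).trans_eq ?_⟩
  set b := (∑ i, if N i then v i else 0) / ∑ i, (if N i then p i else 0) with hb
  have h1 : ∀ i, (if N i then v i - b * p i else 0) =
      (if N i then v i else 0) - b * (if N i then p i else 0) := fun i => by
    split_ifs <;> ring
  simp only [h1]
  rw [Finset.sum_sub_distrib, ← Finset.mul_sum, hb, div_mul_cancel₀ _ hp0]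
  ring

theorem isHyperbolicLink_indepFamily {M : Matroid α} (hE : M.E = Set.univ)
    (hrank : ∃ I : Finset α, M.Indep (I : Set α) ∧ I.card = K) (hp : ∀ e, 0 < p e)
    (hT : T.card + 2 ≤ K) : IsHyperbolicLink (indepFamily M K) K T p := by
  obtain ⟨n, hn⟩ := Nat.exists_eq_add_of_le hT
  induction n generalizing T with
  | zero => exact isHyperbolicLink_indepFamily_of_card_add_two hE hrank hp (by omega)
  | succ n ihn =>
    refine isHyperbolicLink_of_forall_insert (fun S hS => (mem_indepFamily.1 hS).1) hp (by omega)
      (fun i hi => ?_) fun i j => linkHess_indepFamily_connected hrank hp hT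
    have := Finset.card_insert_of_notMem hi
    exact ihn (by omega) (by omega)

theorem linkPoly_mul_linkForm_le_sq {M : Matroid α} (hE : M.E = Set.univ)
    (hrank : ∃ I : Finset α, M.Indep (I : Set α) ∧ I.card = K) (hK : 1 ≤ K) (hp : ∀ e, 0 < p e)
    (v : α → ℝ) :
    linkPoly (indepFamily M K) ∅ p * linkForm (indepFamily M K) ∅ p v ≤
      (∑ i, v i * linkGrad (indepFamily M K) ∅ p i) ^ 2 := by
  have hhyp : IsHyperbolicLink (indepFamily M K) K ∅ p := by
    rcases hK.eq_or_lt with h | h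
    · refine isHyperbolicLink_of_shift (fun S hS => (mem_indepFamily.1 hS).1) hp (by simp [h])
        fun _ v => ⟨0, le_of_eq ?_⟩
      refine Finset.sum_eq_zero fun i _ => Finset.sum_eq_zero fun j _ => ?_
      have : ¬ 0 < linkHess (indepFamily M K) ∅ p i j := by
        rw [linkHess_indepFamily_pos_iff hrank hp, Finset.card_empty]
        rintro ⟨-, -, -, h'⟩
        omega
      rw [le_antisymm (not_lt.1 this) (linkHess_nonneg (fun e => (hp e).le) i j)]
      ring
    · exact isHyperbolicLink_indepFamily hE hrank hp (by rw [Finset.card_empty]; omega)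
  have h1 := hhyp v
  have hK' : (1 : ℝ) ≤ K := by exact_mod_cast hK
  simp only [Finset.card_empty, Nat.cast_zero, sub_zero] at h1
  have h2 := sq_nonneg (∑ i, v i * linkGrad (indepFamily M K) ∅ p i)
  refine le_of_mul_le_mul_left ?_ (show (0 : ℝ) < K by linarith)
  nlinarith

/-- The generating polynomial of the independent sets of size `K` is log-concave along segments in
the open positive orthant; in particular its superlevel sets there are convex. -/
theorem le_linkPoly_indepFamily_segment {M : Matroid α} (hE : M.E = Set.univ)
    (hrank : ∃ I : Finset α, M.Indep (I : Set α) ∧ I.card = K) (hK : 1 ≤ K)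
    {x y : α → ℝ} (hx : ∀ e, 0 < x e) (hy : ∀ e, 0 < y e) {m : ℝ}
    (hmx : m ≤ linkPoly (indepFamily M K) ∅ x) (hmy : m ≤ linkPoly (indepFamily M K) ∅ y)
    {t : ℝ} (ht : t ∈ Set.Icc (0 : ℝ) 1) :
    m ≤ linkPoly (indepFamily M K) ∅ fun e => x e + t * (y e - x e) := by
  set v : α → ℝ := fun e => y e - x e with hv
  set f : ℝ → ℝ := fun s => linkPoly (indepFamily M K) ∅ fun e => x e + s * v e with hf
  set f' : ℝ → ℝ := fun s =>
    ∑ i, v i * linkGrad (indepFamily M K) ∅ (fun e => x e + s * v e) i with hf'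
  have hxy : ∀ s ∈ Set.Icc (0 : ℝ) 1, ∀ e, 0 < x e + s * v e := by
    rintro s ⟨hs0, hs1⟩ e
    have h1 : x e + s * v e = (1 - s) * x e + s * y e := by simp only [hv]; ring
    rw [h1]
    rcases hs0.eq_or_lt with h | h
    · rw [← h]; simpa using hx e
    · have := mul_nonneg (sub_nonneg.2 hs1) (hx e).le
      have := mul_pos h (hy e)
      linarith
  have hfpos : ∀ s ∈ Set.Icc (0 : ℝ) 1, 0 < f s := fun s hs =>
    (linkPoly_indepFamily_pos_iff hrank (hxy s hs)).2 ⟨by simp, by simp⟩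
  have hdf : ∀ s, HasDerivAt f (f' s) s := fun s => hasDerivAt_linkPoly x v s
  have hdf' : ∀ s, HasDerivAt f'
      (linkForm (indepFamily M K) ∅ (fun e => x e + s * v e) v) s := by
    intro s
    have h := HasDerivAt.fun_sum (u := Finset.univ)
      (A := fun i s => v i * linkGrad (indepFamily M K) ∅ (fun e => x e + s * v e) i)
      fun i _ => (hasDerivAt_linkGrad x v s i).const_mul (v i)
    refine h.congr_deriv ?_
    symm
    refine Finset.sum_congr rfl fun i _ => ?_
    rw [Finset.mul_sum]
    refine Finset.sum_congr rfl fun j _ => ?_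
    ring
  have hconc : ConcaveOn ℝ (Set.Icc (0 : ℝ) 1) fun s => Real.log (f s) := by
    have hsub : ∀ s ∈ interior (Set.Icc (0 : ℝ) 1), s ∈ Set.Icc (0 : ℝ) 1 :=
      fun s hs => interior_subset hs
    refine concaveOn_of_hasDerivWithinAt2_nonpos (convex_Icc 0 1)
      (fun s hs => ((hdf s).log (hfpos s hs).ne').continuousAt.continuousWithinAt)
      (fun s hs => ((hdf s).log (hfpos s (hsub s hs)).ne').hasDerivWithinAt)
      (fun s hs => ((hdf' s).div (hdf s) (hfpos s (hsub s hs)).ne').hasDerivWithinAt)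
      fun s hs => ?_
    refine div_nonpos_of_nonpos_of_nonneg ?_ (sq_nonneg _)
    have := linkPoly_mul_linkForm_le_sq hE hrank hK (hxy s (hsub s hs)) v
    change f s * _ ≤ f' s ^ 2 at this
    linarith
  have h0 : (0 : ℝ) ∈ Set.Icc (0 : ℝ) 1 := by simp
  have h1 : (1 : ℝ) ∈ Set.Icc (0 : ℝ) 1 := by simp
  have hmin := hconc.min_le_of_mem_Icc h0 h1 ht
  have e0 : f 0 = linkPoly (indepFamily M K) ∅ x := by simp [hf]
  have e1 : f 1 = linkPoly (indepFamily M K) ∅ y := by simp [hf, hv]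
  rcases min_le_iff.1 hmin with h | h
  · have := (Real.log_le_log_iff (hfpos 0 h0) (hfpos t ht)).1 h
    linarith
  · have := (Real.log_le_log_iff (hfpos 1 h1) (hfpos t ht)).1 h
    linarith

theorem convex_setOf_le_linkPoly_indepFamily {M : Matroid α} (hE : M.E = Set.univ)
    (hrank : ∃ I : Finset α, M.Indep (I : Set α) ∧ I.card = K) (hK : 1 ≤ K) (m : ℝ) :
    Convex ℝ {x : α → ℝ | (∀ e, 0 ≤ x e) ∧ m ≤ linkPoly (indepFamily M K) ∅ x} := by
  rintro x ⟨hx, hmx⟩ y ⟨hy, hmy⟩ a b ha hb hab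
  refine ⟨fun e => add_nonneg (mul_nonneg ha (hx e)) (mul_nonneg hb (hy e)), ?_⟩
  have hlim : Filter.Tendsto (fun ε : ℝ => linkPoly (indepFamily M K) ∅
      fun e => (a • x + b • y) e + ε) (nhdsWithin 0 (Set.Ioi 0))
      (nhds (linkPoly (indepFamily M K) ∅ (a • x + b • y))) := by
    have hcont : Continuous fun ε : ℝ => linkPoly (indepFamily M K) ∅
        fun e => (a • x + b • y) e + ε :=
      (continuous_linkPoly _ _).comp (continuous_pi fun e => continuous_const.add continuous_id)
    have h := (hcont.tendsto 0).mono_left (nhdsWithin_le_nhds (s := Set.Ioi 0))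
    simp only [add_zero] at h
    exact h
  refine ge_of_tendsto hlim (eventually_mem_nhdsWithin.mono fun ε (hε : 0 < ε) => ?_)
  have h := le_linkPoly_indepFamily_segment hE hrank hK
    (x := fun e => x e + ε) (y := fun e => y e + ε) (m := m) (t := b)
    (fun e => add_pos_of_nonneg_of_pos (hx e) hε) (fun e => add_pos_of_nonneg_of_pos (hy e) hε)
    (hmx.trans (linkPoly_mono hx fun e => by linarith))
    (hmy.trans (linkPoly_mono hy fun e => by linarith)) ⟨hb, by linarith⟩
  refine h.trans_eq (congrArg _ (funext fun e => ?_))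
  simp only [Pi.add_apply, Pi.smul_apply, smul_eq_mul]
  linear_combination (-(x e)) * hab

theorem indepProb_eq_factorial_mul_linkPoly (M : Matroid α) (K : ℕ) (p : α → ℝ) :
    indepProb M K p = K.factorial * linkPoly (indepFamily M K) ∅ p := by
  simp [indepProb, linkPoly, indepFamily, Finset.sum_filter]

theorem linkPoly_indepFamily_comp_perm {M : Matroid α} (g : Equiv.Perm α)
    (hg : ∀ S : Set α, M.Indep (g '' S) ↔ M.Indep S) (p : α → ℝ) :
    linkPoly (indepFamily M K) ∅ (fun e => p (g e)) = linkPoly (indepFamily M K) ∅ p := by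
  simp only [linkPoly, Finset.empty_subset, Finset.filter_true, Finset.sdiff_empty]
  refine Finset.sum_equiv g.finsetCongr (fun S => ?_) fun S _ => ?_
  · simp [mem_indepFamily, hg]
  · simp [Equiv.finsetCongr_apply]

end LinkPolynomials

/-- **Orbit-constant maximizers.** For any subgroup `G` of the automorphism group of a
matroid `M` and `1 ≤ K ≤ rank M`, there exists a maximizer of `F_{M,K}` over the
probability simplex that is constant on each `G`-orbit. -/
theorem exists_maximizer_constant_on_orbits {α : Type*} [Fintype α] (M : Matroid α)
    (hE : M.E = Set.univ) (K : ℕ) (hK : 1 ≤ K)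
    (hrank : ∃ I : Finset α, M.Indep (I : Set α) ∧ I.card = K)
    (G : Subgroup (Equiv.Perm α))
    (hG : ∀ g ∈ G, ∀ S : Set α, M.Indep (g '' S) ↔ M.Indep S) :
    ∃ p : α → ℝ, (∀ e, 0 ≤ p e) ∧ (∑ e, p e = 1) ∧
      (∀ q : α → ℝ, (∀ e, 0 ≤ q e) → (∑ e, q e = 1) →
        indepProb M K q ≤ indepProb M K p) ∧
      (∀ g ∈ G, ∀ e : α, p (g e) = p e) := by
  have : Nonempty α := by
    obtain ⟨I, -, hI⟩ := hrank
    obtain ⟨e, -⟩ := Finset.card_pos.1 (by omega : 0 < I.card)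
    exact ⟨e⟩
  set F : (α → ℝ) → ℝ := linkPoly (indepFamily M K) ∅ with hF
  obtain ⟨q₀, hq₀, hmax⟩ := (isCompact_stdSimplex ℝ α).exists_isMaxOn
    ⟨_, single_mem_stdSimplex ℝ (Classical.arbitrary α)⟩
    (continuous_linkPoly (indepFamily M K) ∅).continuousOn
  set C : Set (α → ℝ) := stdSimplex ℝ α ∩ {x | (∀ e, 0 ≤ x e) ∧ F q₀ ≤ F x}
  have hC : Convex ℝ C := (convex_stdSimplex ℝ α).inter
    (convex_setOf_le_linkPoly_indepFamily hE hrank hK _)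
  have hmem : ∀ g : G, (fun e => q₀ ((g : Equiv.Perm α) e)) ∈ C := fun g =>
    ⟨⟨fun e => hq₀.1 _, (Equiv.sum_comp (g : Equiv.Perm α) q₀).trans hq₀.2⟩,
      fun e => hq₀.1 _, (linkPoly_indepFamily_comp_perm _ (hG g g.2) q₀).ge⟩
  have hcard : (0 : ℝ) < Fintype.card G := Nat.cast_pos.2 Fintype.card_pos
  have hp := hC.sum_mem (t := Finset.univ) (w := fun _ : G => (Fintype.card G : ℝ)⁻¹)
    (fun _ _ => (inv_pos.2 hcard).le) (by simp [hcard.ne']) fun g _ => hmem g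
  refine ⟨_, hp.1.1, hp.1.2, fun q hq0 hq1 => ?_, fun g hg e => ?_⟩
  · rw [indepProb_eq_factorial_mul_linkPoly, indepProb_eq_factorial_mul_linkPoly]
    exact mul_le_mul_of_nonneg_left ((hmax ⟨hq0, hq1⟩).trans hp.2.2) (Nat.cast_nonneg _)
  · simp only [Finset.sum_apply, Pi.smul_apply]
    exact Fintype.sum_equiv (Equiv.mulRight (⟨g, hg⟩ : G)) _ _ fun h => by simp
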